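/- arXiv:0712.2891 — 6 statements merged into one kernel-verified Lean document; each statement's English description precedes it below -/
import Mathlib

section
/- Let m ≥ 2 and let A₀ = (a⁰_{ki}) and A₁ = (a¹_{ki}) be transversal real skew-symmetric m×m matrices with entries of absolute value ≤ 1. If the Volterra operators V_{A₀} and V_{A₁} are homotopic, then all corresponding off-diagonal entries of A₀ and A₁ have the same sign; that is, a⁰_{ki} · a¹_{ki} > 0 for all k ≠ i. -/
open Matrix

/-- A matrix defining a Volterra quadratic stochastic operator:
skew-symmetric with entries of absolute value at most 1. -/
def IsQSOMatrix {n : Type*} [Fintype n] (A : Matrix n n ℝ) : Prop :=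
  Aᵀ = -A ∧ ∀ i j, |A i j| ≤ 1

/-- The Volterra quadratic stochastic operator associated to a matrix `A`:
`(V_A x)_k = x_k (1 + ∑ i, a_{k i} x_i)`. -/
noncomputable def volterra {n : Type*} [Fintype n] (A : Matrix n n ℝ) (x : n → ℝ) : n → ℝ :=
  fun k => x k * (1 + ∑ i, A k i * x i)

/-- The set of fixed points of `V_A` in the standard simplex. -/
def FixSet {n : Type*} [Fintype n] (A : Matrix n n ℝ) : Set (n → ℝ) :=
  {x ∈ stdSimplex ℝ n | volterra A x = x}

/-- A skew-symmetric matrix is transversal if every principal submatrix on an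
evenly-sized index set has nonzero determinant. -/
def IsTransversal {n : Type*} [Fintype n] [DecidableEq n] (A : Matrix n n ℝ) : Prop :=
  ∀ s : Finset n, Even s.card →
    (A.submatrix (fun i : s => (i : n)) (fun i : s => (i : n))).det ≠ 0

/-- Two (transversal) Volterra operators are homotopic if they are joined by a
continuous family of transversal Volterra matrices along which the number of
fixed points is constant. -/
def QSOHomotopic {n : Type*} [Fintype n] [DecidableEq n] (A₀ A₁ : Matrix n n ℝ) : Prop :=
  ∃ A : ℝ → Matrix n n ℝ,
    ContinuousOn A (Set.Icc 0 1) ∧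
    A 0 = A₀ ∧ A 1 = A₁ ∧
    (∀ t ∈ Set.Icc (0:ℝ) 1, IsQSOMatrix (A t) ∧ IsTransversal (A t)) ∧
    (∀ t ∈ Set.Icc (0:ℝ) 1, (FixSet (A t)).ncard = (FixSet A₀).ncard) ∧
    (FixSet A₀).ncard = (FixSet A₁).ncard

/-- Off-diagonal entries of a skew-symmetric transversal matrix are nonzero. -/
theorem IsTransversal.apply_ne_zero {n : Type*} [Fintype n] [DecidableEq n] {A : Matrix n n ℝ}
    (hA : Aᵀ = -A) (ht : IsTransversal A) {k i : n} (hki : k ≠ i) : A k i ≠ 0 := by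
  intro h0
  have hskew : ∀ a b, A b a = -A a b := fun a b => congrFun (congrFun hA a) b
  have hik : A i k = 0 := by rw [hskew k i, h0, neg_zero]
  have hkk : A k k = 0 := by linarith [hskew k k]
  refine ht {k, i} (by rw [Finset.card_pair hki]; exact even_two)
    (Matrix.det_eq_zero_of_row_eq_zero ⟨k, by simp⟩ ?_)
  rintro ⟨j, hj⟩
  rcases Finset.mem_insert.mp hj with rfl | hj
  · exact hkk
  · obtain rfl := Finset.mem_singleton.mp hj
    exact h0

theorem homotopic_entries_same_sign {m : ℕ} (hm : 2 ≤ m)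
    (A₀ A₁ : Matrix (Fin m) (Fin m) ℝ)
    (h₀ : IsQSOMatrix A₀) (h₁ : IsQSOMatrix A₁)
    (t₀ : IsTransversal A₀) (t₁ : IsTransversal A₁)
    (h : QSOHomotopic A₀ A₁) :
    ∀ k i : Fin m, k ≠ i → A₀ k i * A₁ k i > 0 := by
  intro k i hki
  obtain ⟨A, hcont, rfl, rfl, hA, -, -⟩ := h
  have hc : ContinuousOn (fun t => A t k i) (Set.uIcc 0 1) := by
    rw [Set.uIcc_of_le zero_le_one]
    exact (continuous_id.matrix_elem k i).comp_continuousOn hcont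
  by_contra hneg
  have hmem : (0 : ℝ) ∈ Set.uIcc (A 0 k i) (A 1 k i) := by
    rw [Set.mem_uIcc]
    rcases mul_nonpos_iff.mp (not_lt.mp hneg) with h | h
    · exact Or.inr ⟨h.2, h.1⟩
    · exact Or.inl h
  obtain ⟨t, ht, h0⟩ := intermediate_value_uIcc hc hmem
  rw [Set.uIcc_of_le zero_le_one] at ht
  exact (hA t ht).2.apply_ne_zero (hA t ht).1.1 hki h0
end

section
/- Let m ≥ 4 and let A₀ = (a⁰_{ki}) and A₁ = (a¹_{ki}) be transversal real skew-symmetric m×m matrices with entries of absolute value ≤ 1. If V_{A₀} and V_{A₁} are homotopic, then for all indices i₁ < i₂ < i₃ < i₄ in {1,…,m} the fourth-order main subpfaffians gp^{(j)} = a^{(j)}_{i₁i₂} a^{(j)}_{i₃i₄} + a^{(j)}_{i₁i₄} a^{(j)}_{i₂i₃} − a^{(j)}_{i₁i₃} a^{(j)}_{i₂i₄} (j = 0, 1) have the same sign, i.e. gp^{(0)} · gp^{(1)} > 0. -/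
open Matrix

/-- The principal submatrix of a transversal matrix along an injective family indexed by a type of
even cardinality is nonsingular. -/
theorem IsTransversal.det_submatrix_ne_zero {n ι : Type*} [Fintype n] [DecidableEq n]
    [Fintype ι] [DecidableEq ι] {A : Matrix n n ℝ} (hA : IsTransversal A)
    {f : ι → n} (hf : Function.Injective f) (hι : Even (Fintype.card ι)) :
    (A.submatrix f f).det ≠ 0 := by
  have hcard : (Finset.univ.image f).card = Fintype.card ι :=
    Finset.card_image_of_injective _ hf
  have hdet := hA (Finset.univ.image f) (hcard ▸ hι)
  let e : ι ≃ Finset.univ.image f := Equiv.ofBijective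
    (fun i => ⟨f i, Finset.mem_image_of_mem f (Finset.mem_univ i)⟩)
    ⟨fun i j hij => hf (congrArg Subtype.val hij), fun ⟨x, hx⟩ => by
      obtain ⟨i, -, hi⟩ := Finset.mem_image.1 hx
      exact ⟨i, Subtype.ext hi⟩⟩
  rwa [← Matrix.det_submatrix_equiv_self e, Matrix.submatrix_submatrix] at hdet

/-- The determinant of a skew-symmetric `4 × 4` matrix is the square of its Pfaffian. -/
theorem det_fin_four_of_skew {R : Type*} [CommRing R] (B : Matrix (Fin 4) (Fin 4) R)
    (hB : Bᵀ = -B) (hdiag : ∀ i, B i i = 0) :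
    B.det = (B 0 1 * B 2 3 + B 0 3 * B 1 2 - B 0 2 * B 1 3) ^ 2 := by
  have hskew : ∀ i j, B j i = -B i j := fun i j => congrFun (congrFun hB i) j
  have hform : B = !![0, B 0 1, B 0 2, B 0 3; -B 0 1, 0, B 1 2, B 1 3;
      -B 0 2, -B 1 2, 0, B 2 3; -B 0 3, -B 1 3, -B 2 3, 0] := by
    ext i j
    fin_cases i <;> fin_cases j <;> simp [hdiag, hskew 0 1, hskew 0 2, hskew 0 3, hskew 1 2,
      hskew 1 3, hskew 2 3]
  rw [hform]
  simp [Matrix.det_succ_row_zero, Fin.sum_univ_succ, Fin.succAbove]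
  ring

/-- Fourth-order subpfaffians of a transversal skew-symmetric matrix do not vanish. -/
theorem IsTransversal.subpfaffian_ne_zero {n : Type*} [Fintype n] [DecidableEq n]
    {A : Matrix n n ℝ} (hA : IsTransversal A) (hskew : Aᵀ = -A)
    {f : Fin 4 → n} (hf : Function.Injective f) :
    A (f 0) (f 1) * A (f 2) (f 3) + A (f 0) (f 3) * A (f 1) (f 2)
      - A (f 0) (f 2) * A (f 1) (f 3) ≠ 0 := by
  have hdet := hA.det_submatrix_ne_zero hf (by decide)
  have hentry : ∀ i j, A j i = -A i j := fun i j => congrFun (congrFun hskew i) j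
  rw [det_fin_four_of_skew _ (by ext i j; exact hentry (f i) (f j))
    (fun i => self_eq_neg.1 (hentry (f i) (f i)))] at hdet
  exact pow_ne_zero_iff two_ne_zero |>.1 hdet

/-- A continuous real function without zeros on `[a, b]` has the same sign at both ends. -/
theorem ContinuousOn.mul_pos_of_ne_zero {a b : ℝ} (hab : a ≤ b) {g : ℝ → ℝ}
    (hg : ContinuousOn g (Set.Icc a b)) (hne : ∀ t ∈ Set.Icc a b, g t ≠ 0) :
    0 < g a * g b := by
  by_contra! hle
  have hzero : (0 : ℝ) ∈ Set.uIcc (g a) (g b) := by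
    rw [Set.mem_uIcc]
    rcases mul_nonpos_iff.1 hle with h | h
    · exact Or.inr ⟨h.2, h.1⟩
    · exact Or.inl h
  rw [← Set.uIcc_of_le hab] at hg hne
  obtain ⟨t, ht, hgt⟩ := intermediate_value_uIcc hg hzero
  exact hne t ht hgt

theorem homotopic_fourth_order_subpfaffians_same_sign {m : ℕ} (hm : 4 ≤ m)
    (A₀ A₁ : Matrix (Fin m) (Fin m) ℝ)
    (h₀ : IsQSOMatrix A₀) (h₁ : IsQSOMatrix A₁)
    (t₀ : IsTransversal A₀) (t₁ : IsTransversal A₁)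
    (h : QSOHomotopic A₀ A₁) :
    ∀ i₁ i₂ i₃ i₄ : Fin m, i₁ < i₂ → i₂ < i₃ → i₃ < i₄ →
      (A₀ i₁ i₂ * A₀ i₃ i₄ + A₀ i₁ i₄ * A₀ i₂ i₃ - A₀ i₁ i₃ * A₀ i₂ i₄) *
      (A₁ i₁ i₂ * A₁ i₃ i₄ + A₁ i₁ i₄ * A₁ i₂ i₃ - A₁ i₁ i₃ * A₁ i₂ i₄) > 0 := by
  intro i₁ i₂ i₃ i₄ h₁₂ h₂₃ h₃₄
  obtain ⟨A, hcont, rfl, rfl, hA, -, -⟩ := h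
  have hinj : Function.Injective ![i₁, i₂, i₃, i₄] := by
    refine StrictMono.injective (Fin.strictMono_iff_lt_succ.2 fun i => ?_)
    fin_cases i
    exacts [h₁₂, h₂₃, h₃₄]
  have hentry : ∀ i j, ContinuousOn (fun t => A t i j) (Set.Icc 0 1) := fun i j =>
    (continuous_id.matrix_elem i j).comp_continuousOn hcont
  exact ContinuousOn.mul_pos_of_ne_zero zero_le_one
    ((((hentry i₁ i₂).mul (hentry i₃ i₄)).add ((hentry i₁ i₄).mul (hentry i₂ i₃))).sub
      ((hentry i₁ i₃).mul (hentry i₂ i₄)))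
    fun t ht => (hA t ht).2.subpfaffian_ne_zero (hA t ht).1.1 hinj
end

section
/- Let m = 2 and let A₀, A₁ be transversal real skew-symmetric 2×2 matrices with entries of absolute value ≤ 1 (transversality here means the entry a₁₂ is nonzero). Then V_{A₀} and V_{A₁} are homotopic if and only if a⁰₁₂ and a¹₁₂ have the same sign, i.e. a⁰₁₂ · a¹₁₂ > 0. -/
open Matrix

section DimTwo

variable {A : Matrix (Fin 2) (Fin 2) ℝ}

/-- A skew-symmetric `2 × 2` matrix is determined by its upper right entry. -/
lemma IsQSOMatrix.entries_fin_two (h : IsQSOMatrix A) :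
    A 0 0 = 0 ∧ A 1 1 = 0 ∧ A 1 0 = -A 0 1 := by
  have e (i j : Fin 2) : A j i = -A i j := congrFun (congrFun h.1 i) j
  exact ⟨by linarith [e 0 0], by linarith [e 1 1], e 0 1⟩

lemma IsQSOMatrix.det_fin_two (h : IsQSOMatrix A) : A.det = A 0 1 ^ 2 := by
  obtain ⟨h00, h11, h10⟩ := h.entries_fin_two
  rw [Matrix.det_fin_two, h00, h11, h10]
  ring

lemma isTransversal_fin_two_iff_det_ne_zero : IsTransversal A ↔ A.det ≠ 0 := by
  have huniv : (A.submatrix (fun i : (Finset.univ : Finset (Fin 2)) => (i : Fin 2))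
      (fun i : (Finset.univ : Finset (Fin 2)) => (i : Fin 2))).det = A.det :=
    Matrix.det_submatrix_equiv_self (Equiv.subtypeUnivEquiv Finset.mem_univ) A
  refine ⟨fun h => huniv ▸ h Finset.univ (by simp), fun h s hs => ?_⟩
  have hcases : s = ∅ ∨ s = Finset.univ := by
    revert s
    decide
  obtain rfl | rfl := hcases
  · simp
  · rwa [huniv]

lemma IsQSOMatrix.isTransversal_fin_two_iff (h : IsQSOMatrix A) :
    IsTransversal A ↔ A 0 1 ≠ 0 := by
  rw [isTransversal_fin_two_iff_det_ne_zero, h.det_fin_two, pow_ne_zero_iff two_ne_zero]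

/-- The fixed points of a transversal operator on the segment are its end points. -/
lemma IsQSOMatrix.fixSet_fin_two (h : IsQSOMatrix A) (hA : A 0 1 ≠ 0) :
    FixSet A = {x ∈ stdSimplex ℝ (Fin 2) | x 0 * x 1 = 0} := by
  obtain ⟨h00, h11, h10⟩ := h.entries_fin_two
  ext x
  refine and_congr_right fun _ => ?_
  simp only [funext_iff, Fin.forall_fin_two, volterra, Fin.sum_univ_two, h00, h11, h10]
  constructor
  · rintro ⟨hx, -⟩
    exact (mul_eq_zero.mp (show A 0 1 * (x 0 * x 1) = 0 by linarith)).resolve_left hA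
  · intro hx
    exact ⟨by linear_combination A 0 1 * hx, by linear_combination -A 0 1 * hx⟩

lemma IsQSOMatrix.fixSet_eq_fin_two {B : Matrix (Fin 2) (Fin 2) ℝ} (hA : IsQSOMatrix A)
    (hB : IsQSOMatrix B) (hA' : A 0 1 ≠ 0) (hB' : B 0 1 ≠ 0) : FixSet A = FixSet B := by
  rw [hA.fixSet_fin_two hA', hB.fixSet_fin_two hB']

end DimTwo

/-- Matrices of Volterra operators are stable under convex combinations. -/
lemma IsQSOMatrix.lineMap {n : Type*} [Fintype n] {A B : Matrix n n ℝ} (hA : IsQSOMatrix A)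
    (hB : IsQSOMatrix B) {t : ℝ} (ht : t ∈ Set.Icc (0 : ℝ) 1) :
    IsQSOMatrix ((1 - t) • A + t • B) := by
  refine ⟨?_, fun i j => ?_⟩
  · rw [transpose_add, transpose_smul, transpose_smul, hA.1, hB.1]
    module
  · have h1 := abs_le.mp (hA.2 i j)
    have h2 := abs_le.mp (hB.2 i j)
    simp only [Matrix.add_apply, Matrix.smul_apply, smul_eq_mul]
    have ht' := sub_nonneg.mpr ht.2
    exact abs_le.mpr ⟨by nlinarith [ht.1], by nlinarith [ht.1]⟩

/-- A function that is continuous and nowhere zero on `[a, b]` has the same sign at both ends. -/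
lemma mul_pos_of_continuousOn_of_ne_zero {f : ℝ → ℝ} {a b : ℝ} (hab : a ≤ b)
    (hf : ContinuousOn f (Set.Icc a b)) (hne : ∀ t ∈ Set.Icc a b, f t ≠ 0) :
    0 < f a * f b := by
  by_contra! hle
  have hmem : (0 : ℝ) ∈ Set.uIcc (f a) (f b) := by
    rw [Set.mem_uIcc]
    rcases mul_nonpos_iff.mp hle with h | h <;> tauto
  rw [← Set.uIcc_of_le hab] at hf hne
  obtain ⟨t, ht, h0⟩ := intermediate_value_uIcc hf hmem
  exact hne t ht h0

/-- A convex combination of two nonzero reals of the same sign is nonzero. -/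
lemma convexCombo_ne_zero_of_mul_pos {a b t : ℝ} (hab : 0 < a * b)
    (ht : t ∈ Set.Icc (0 : ℝ) 1) : (1 - t) * a + t * b ≠ 0 := by
  obtain ⟨h0, h1⟩ := ht
  have ht' := sub_nonneg.mpr h1
  rcases mul_pos_iff.mp hab with ⟨ha, hb⟩ | ⟨ha, hb⟩
  · rcases h0.eq_or_lt with rfl | h0
    · simpa using ha.ne'
    · positivity
  · rcases h0.eq_or_lt with rfl | h0
    · simpa using ha.ne
    · exact (add_neg_of_nonpos_of_neg (mul_nonpos_of_nonneg_of_nonpos ht' ha.le)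
        (mul_neg_of_pos_of_neg h0 hb)).ne

theorem homotopic_iff_dim_two (A₀ A₁ : Matrix (Fin 2) (Fin 2) ℝ)
    (h₀ : IsQSOMatrix A₀) (h₁ : IsQSOMatrix A₁)
    (t₀ : IsTransversal A₀) (t₁ : IsTransversal A₁) :
    QSOHomotopic A₀ A₁ ↔ A₀ 0 1 * A₁ 0 1 > 0 := by
  have n₀ := h₀.isTransversal_fin_two_iff.mp t₀
  have n₁ := h₁.isTransversal_fin_two_iff.mp t₁
  constructor
  · rintro ⟨A, hcont, rfl, rfl, hA, -, -⟩
    exact mul_pos_of_continuousOn_of_ne_zero (f := fun t => A t 0 1) zero_le_one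
      ((continuous_id.matrix_elem 0 1).comp_continuousOn hcont)
      fun t ht => (hA t ht).1.isTransversal_fin_two_iff.mp (hA t ht).2
  · intro hpos
    have hq (t : ℝ) (ht : t ∈ Set.Icc (0 : ℝ) 1) := h₀.lineMap h₁ ht
    have hn (t : ℝ) (ht : t ∈ Set.Icc (0 : ℝ) 1) : ((1 - t) • A₀ + t • A₁) 0 1 ≠ 0 :=
      convexCombo_ne_zero_of_mul_pos hpos ht
    refine ⟨fun t => (1 - t) • A₀ + t • A₁, by fun_prop, by simp, by simp, fun t ht =>
      ⟨hq t ht, (hq t ht).isTransversal_fin_two_iff.mpr (hn t ht)⟩, fun t ht => ?_, ?_⟩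
    · rw [(hq t ht).fixSet_eq_fin_two h₀ (hn t ht) n₀]
    · rw [h₀.fixSet_eq_fin_two h₁ n₀ n₁]
end

section
/- Let m = 4 and let A₀ = (a⁰_{ij}), A₁ = (a¹_{ij}) be transversal real skew-symmetric 4×4 matrices with entries of absolute value ≤ 1. Then V_{A₀} and V_{A₁} are homotopic if and only if both of the following hold: (1) a⁰_{ij} · a¹_{ij} > 0 for all 1 ≤ i < j ≤ 4, and (2) the pfaffians gp^{(j)}₁₂₃₄ = a^{(j)}₁₂ a^{(j)}₃₄ + a^{(j)}₁₄ a^{(j)}₂₃ − a^{(j)}₁₃ a^{(j)}₂₄ (j = 0, 1) satisfy gp^{(0)}₁₂₃₄ · gp^{(1)}₁₂₃₄ > 0. -/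
open Matrix

section FixedPoints

variable {n : Type*} [Fintype n]

lemma mem_fixSet_iff {A : Matrix n n ℝ} {x : n → ℝ} :
    x ∈ FixSet A ↔ x ∈ stdSimplex ℝ n ∧ ∀ k, x k ≠ 0 → (A *ᵥ x) k = 0 := by
  refine and_congr_right fun _ => ?_
  rw [funext_iff]
  refine forall_congr' fun k => ?_
  change x k * (1 + (A *ᵥ x) k) = x k ↔ _
  rw [mul_add, mul_one, add_eq_left, mul_eq_zero, or_iff_not_imp_left]

lemma IsQSOMatrix.apply_swap {A : Matrix n n ℝ} (hA : IsQSOMatrix A) (i j : n) :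
    A j i = -A i j :=
  congr_fun (congr_fun hA.1 i) j

lemma IsQSOMatrix.apply_self {A : Matrix n n ℝ} (hA : IsQSOMatrix A) (i : n) : A i i = 0 := by
  linarith [hA.apply_swap i i]

/-- A cyclic triple of indices is the support of a fixed point, whose coordinates are
proportional to the opposite matrix entries. -/
lemma cyclic_mem_fixSet [DecidableEq n] {B : Matrix n n ℝ} (hB : IsQSOMatrix B) {i j k : n}
    (hij : i ≠ j) (hik : i ≠ k) (hjk : j ≠ k) (h₁ : 0 < B i j * B j k) (h₂ : 0 < B j k * B k i) :
    ∃ y ∈ FixSet B, Finset.univ.filter (fun l => y l ≠ 0) = {i, j, k} := by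
  have e₁ : B i j ≠ 0 := left_ne_zero_of_mul h₁.ne'
  have e₂ : B j k ≠ 0 := left_ne_zero_of_mul h₂.ne'
  have e₃ : B k i ≠ 0 := right_ne_zero_of_mul h₂.ne'
  set S := B i j + B j k + B k i with hS
  have hSj : 0 < B j k * S := by nlinarith [sq_nonneg (B j k)]
  have hS0 : S ≠ 0 := right_ne_zero_of_mul hSj.ne'
  have h₃ : 0 < B k i * B i j := by
    have : 0 < (B k i * B i j) * (B j k) ^ 2 := by nlinarith [mul_pos h₁ h₂]
    exact pos_of_mul_pos_left this (sq_nonneg _)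
  have pos : ∀ b : ℝ, 0 < b * S → 0 ≤ b / S := fun b hb => by
    rw [← mul_div_mul_right b S hS0]
    exact (div_pos hb (mul_self_pos.2 hS0)).le
  let y : n → ℝ := Pi.single i (B j k / S) + Pi.single j (B k i / S) + Pi.single k (B i j / S)
  have yi : y i = B j k / S := by simp [y, hij, hik]
  have yj : y j = B k i / S := by simp [y, hij.symm, hjk]
  have yk : y k = B i j / S := by simp [y, hik.symm, hjk.symm]
  have yo : ∀ l, l ≠ i → l ≠ j → l ≠ k → y l = 0 := fun l a b c => by simp [y, a, b, c]
  have hmul : ∀ l, (B *ᵥ y) l = (B l i * B j k + B l j * B k i + B l k * B i j) / S := fun l => by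
    simp only [y, mulVec_add, mulVec_single, Pi.add_apply, Pi.smul_apply, Matrix.col_apply,
      MulOpposite.smul_eq_mul_unop, MulOpposite.unop_op]
    ring
  refine ⟨y, mem_fixSet_iff.2 ⟨⟨fun l => ?_, ?_⟩, fun l hl => ?_⟩, ?_⟩
  · by_cases a : l = i
    · subst a; rw [yi]; exact pos _ hSj
    by_cases b : l = j
    · subst b; rw [yj]; exact pos _ (by nlinarith [sq_nonneg (B k i)])
    by_cases c : l = k
    · subst c; rw [yk]; exact pos _ (by nlinarith [sq_nonneg (B i j)])
    exact (yo l a b c).ge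
  · simp only [y, Pi.add_apply, Finset.sum_add_distrib, Finset.sum_pi_single', Finset.mem_univ,
      if_true]
    field_simp
    linarith
  · rw [hmul, div_eq_zero_iff]
    left
    by_cases a : l = i
    · subst a; rw [hB.apply_self, hB.apply_swap k l]; ring
    by_cases b : l = j
    · subst b; rw [hB.apply_self, hB.apply_swap i l]; ring
    by_cases c : l = k
    · subst c; rw [hB.apply_self, hB.apply_swap j l]; ring
    exact absurd (yo l a b c) hl
  · ext l
    simp only [Finset.mem_filter, Finset.mem_univ, true_and, Finset.mem_insert,
      Finset.mem_singleton]
    constructor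
    · intro hl
      by_contra! h
      exact hl (yo l h.1 h.2.1 h.2.2)
    · rintro (rfl | rfl | rfl)
      · rw [yi]; exact div_ne_zero e₂ hS0
      · rw [yj]; exact div_ne_zero e₃ hS0
      · rw [yk]; exact div_ne_zero e₁ hS0

variable [DecidableEq n]

/-- Transversality expressed through kernels of principal submatrices. -/
lemma isTransversal_iff {A : Matrix n n ℝ} :
    IsTransversal A ↔ ∀ s : Finset n, Even s.card → ∀ z : n → ℝ, (∀ k ∉ s, z k = 0) →
      (∀ k ∈ s, (A *ᵥ z) k = 0) → z = 0 := by
  have key : ∀ (s : Finset n) (z : n → ℝ), (∀ k ∉ s, z k = 0) → ∀ k : s,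
      (A.submatrix (fun i : s => (i : n)) (fun i : s => (i : n)) *ᵥ fun i : s => z i) k
        = (A *ᵥ z) k := by
    intro s z hz k
    simp only [mulVec, dotProduct, submatrix_apply]
    rw [Finset.sum_coe_sort s (fun i => A k i * z i)]
    exact Finset.sum_subset (Finset.subset_univ s) fun i _ hi => by rw [hz i hi, mul_zero]
  refine forall_congr' fun s => imp_congr_right fun _ => ?_
  rw [ne_eq, ← exists_mulVec_eq_zero_iff]
  constructor
  · intro h z hz hk
    by_contra hne
    refine h ⟨fun i => z i, fun h0 => hne ?_, ?_⟩
    · ext i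
      by_cases hi : i ∈ s
      · exact congr_fun h0 ⟨i, hi⟩
      · exact hz i hi
    · ext i
      rw [key s z hz i]
      exact hk i i.2
  · rintro h ⟨z, hne, hz⟩
    let z' : n → ℝ := fun i => if hi : i ∈ s then z ⟨i, hi⟩ else 0
    have hz' : ∀ k ∉ s, z' k = 0 := fun k hk => by simp [z', hk]
    have hres : (fun i : s => z' i) = z := by ext i; simp [z']
    have := h z' hz' fun k hk => by
      rw [← key s z' hz' ⟨k, hk⟩, hres, hz]; rfl
    exact hne (by rw [← hres, this]; rfl)

lemma IsTransversal.apply_ne_zero_s5 {A : Matrix n n ℝ} (hT : IsTransversal A)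
    (hA : IsQSOMatrix A) {i j : n} (hij : i ≠ j) : A i j ≠ 0 := by
  intro h
  have := isTransversal_iff.1 hT {i, j} (by rw [Finset.card_pair hij]; decide) (Pi.single j 1)
    (fun k hk => by
      simp only [Finset.mem_insert, Finset.mem_singleton, not_or] at hk
      simp [hk.2])
    (fun k hk => by
      simp only [Finset.mem_insert, Finset.mem_singleton] at hk
      rcases hk with rfl | rfl
      · simp [h]
      · simp [hA.apply_self])
  simpa using congr_fun this j

lemma IsTransversal.odd_card_support {A : Matrix n n ℝ} (hT : IsTransversal A) {x : n → ℝ}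
    (hx : x ∈ FixSet A) : Odd (Finset.univ.filter (fun l => x l ≠ 0)).card := by
  obtain ⟨hs, hk⟩ := mem_fixSet_iff.1 hx
  by_contra h
  rw [Nat.not_odd_iff_even] at h
  have := isTransversal_iff.1 hT _ h x (fun k hk => by simpa using hk)
    (fun k h' => hk k (by simpa using h'))
  have h1 := hs.2
  simp [this] at h1

/-- A fixed point of a transversal operator is determined by its support. -/
lemma IsTransversal.injOn_support {A : Matrix n n ℝ} (hT : IsTransversal A) :
    Set.InjOn (fun x : n → ℝ => Finset.univ.filter (fun l => x l ≠ 0)) (FixSet A) := by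
  intro x hx y hy hxy
  have hodd := hT.odd_card_support hx
  obtain ⟨hxs, hxk⟩ := mem_fixSet_iff.1 hx
  obtain ⟨hys, hyk⟩ := mem_fixSet_iff.1 hy
  have hsupp : ∀ l, x l ≠ 0 ↔ y l ≠ 0 := fun l => by
    simpa using Finset.ext_iff.1 hxy l
  obtain ⟨p, hp⟩ := Finset.card_pos.1 hodd.pos
  have hpx : x p ≠ 0 := by simpa using hp
  have hz : y p • x - x p • y = 0 := by
    refine isTransversal_iff.1 hT ((Finset.univ.filter (fun l => x l ≠ 0)).erase p) ?_ _ ?_ ?_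
    · rw [Finset.card_erase_of_mem hp]
      exact hodd.tsub_odd odd_one
    · intro k hk
      by_cases hkp : k = p
      · subst hkp; simp [mul_comm]
      · have h0 : x k = 0 := by simpa [hkp] using hk
        have h1 : y k = 0 := by
          by_contra h
          exact (hsupp k).2 h h0
        simp [h0, h1]
    · intro k hk
      have hk' : x k ≠ 0 := by simpa using (Finset.mem_erase.1 hk).2
      simp [mulVec_sub, mulVec_smul, hxk k hk', hyk k ((hsupp k).1 hk')]
  have hz' : ∀ k, y p * x k = x p * y k := fun k => by
    simpa [sub_eq_zero] using congr_fun hz k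
  have hyx : y p = x p := by
    have := Finset.sum_congr rfl fun k (_ : k ∈ Finset.univ) => hz' k
    rwa [← Finset.mul_sum, ← Finset.mul_sum, hxs.2, hys.2, mul_one, mul_one] at this
  ext k
  exact mul_left_cancel₀ hpx (hyx ▸ hz' k)

end FixedPoints

section DimFour

lemma support_image_subset {A B : Matrix (Fin 4) (Fin 4) ℝ} (hA : IsQSOMatrix A)
    (hB : IsQSOMatrix B) (hTA : IsTransversal A)
    (hAB : ∀ i j, i ≠ j → 0 < A i j * B i j) :
    (fun x : Fin 4 → ℝ => Finset.univ.filter (fun l => x l ≠ 0)) '' FixSet A ⊆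
      (fun x : Fin 4 → ℝ => Finset.univ.filter (fun l => x l ≠ 0)) '' FixSet B := by
  rintro _ ⟨x, hx, rfl⟩
  have hodd := hTA.odd_card_support hx
  have hle := Finset.card_le_univ (Finset.univ.filter (fun l => x l ≠ 0))
  obtain ⟨hxs, hxk⟩ := mem_fixSet_iff.1 hx
  simp only [Set.mem_image]
  rw [Fintype.card_fin] at hle
  have hcard : (Finset.univ.filter (fun l => x l ≠ 0)).card = 1 ∨
      (Finset.univ.filter (fun l => x l ≠ 0)).card = 3 := by
    obtain ⟨r, hr⟩ := hodd
    omega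
  rcases hcard with h | h
  · refine ⟨x, mem_fixSet_iff.2 ⟨hxs, fun k hk => ?_⟩, rfl⟩
    obtain ⟨i, hi⟩ := Finset.card_eq_one.1 h
    have hmem : ∀ l, x l ≠ 0 ↔ l = i := fun l => by simpa using Finset.ext_iff.1 hi l
    refine Finset.sum_eq_zero (s := Finset.univ) (f := fun l => B k l * x l) fun l _ => ?_
    by_cases hl : x l = 0
    · simp [hl]
    · rw [(hmem k).1 hk, (hmem l).1 hl, hB.apply_self, zero_mul]
  · obtain ⟨i, j, k, hij, hik, hjk, hs⟩ := Finset.card_eq_three.1 h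
    have hmem : ∀ l, x l ≠ 0 ↔ l = i ∨ l = j ∨ l = k := fun l => by
      simpa using Finset.ext_iff.1 hs l
    have pos : ∀ l, (l = i ∨ l = j ∨ l = k) → 0 < x l := fun l hl =>
      (hxs.1 l).lt_of_ne' ((hmem l).2 hl)
    have hmul : ∀ l, (A *ᵥ x) l = A l i * x i + A l j * x j + A l k * x k := by
      intro l
      have : ∑ m ∈ ({i, j, k} : Finset (Fin 4)), A l m * x m = ∑ m, A l m * x m := by
        rw [← hs]
        refine Finset.sum_subset (Finset.subset_univ _) fun m _ hm => ?_
        have : x m = 0 := by simpa using hm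
        rw [this, mul_zero]
      rw [Finset.sum_insert (by simp [hij, hik]), Finset.sum_pair hjk, ← add_assoc] at this
      exact this.symm
    have xi := pos i (by simp)
    have xj := pos j (by simp)
    have xk := pos k (by simp)
    have ei := hxk i xi.ne'
    have ej := hxk j xj.ne'
    rw [hmul, hA.apply_self, hA.apply_swap k i] at ei
    rw [hmul, hA.apply_self, hA.apply_swap i j] at ej
    have nij := hTA.apply_ne_zero_s5 hA hij
    have nki := hTA.apply_ne_zero_s5 hA hik.symm
    have njk := hTA.apply_ne_zero_s5 hA hjk
    have a₁ : 0 < A i j * A j k := by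
      have : A i j * A j k * x k = A i j ^ 2 * x i := by linear_combination A i j * ej
      exact pos_of_mul_pos_left (this ▸ by positivity) xk.le
    have a₃ : 0 < A i j * A k i := by
      have : A i j * A k i * x k = A i j ^ 2 * x j := by linear_combination -A i j * ei
      exact pos_of_mul_pos_left (this ▸ by positivity) xk.le
    have a₂ : 0 < A j k * A k i := by
      have : 0 < (A j k * A k i) * A i j ^ 2 := by nlinarith [mul_pos a₁ a₃]
      exact pos_of_mul_pos_left this (sq_nonneg _)
    obtain ⟨y, hy, hys⟩ := cyclic_mem_fixSet hB hij hik hjk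
      (pos_of_mul_pos_right (b := B i j * B j k)
        (by nlinarith [mul_pos (hAB i j hij) (hAB j k hjk)]) a₁.le)
      (pos_of_mul_pos_right (b := B j k * B k i)
        (by nlinarith [mul_pos (hAB j k hjk) (hAB k i hik.symm)]) a₂.le)
    exact ⟨y, hy, hys.trans hs.symm⟩

/-- In dimension four the number of fixed points depends only on the signs of the entries. -/
lemma ncard_fixSet_eq {A B : Matrix (Fin 4) (Fin 4) ℝ} (hA : IsQSOMatrix A)
    (hB : IsQSOMatrix B) (hTA : IsTransversal A) (hTB : IsTransversal B)
    (hAB : ∀ i j, i ≠ j → 0 < A i j * B i j) : (FixSet A).ncard = (FixSet B).ncard := by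
  rw [← Set.InjOn.ncard_image hTA.injOn_support, ← Set.InjOn.ncard_image hTB.injOn_support]
  congr 1
  exact (support_image_subset hA hB hTA hAB).antisymm
    (support_image_subset hB hA hTB fun i j h => mul_comm (A i j) _ ▸ hAB i j h)

/-- The skew-symmetric `4 × 4` matrix with first row `(0, v)` whose remaining block is the cross
product matrix of `w`; its pfaffian is `v ⬝ᵥ w`. -/
def skewFour (p : (Fin 3 → ℝ) × (Fin 3 → ℝ)) : Matrix (Fin 4) (Fin 4) ℝ :=
  !![0, p.1 0, p.1 1, p.1 2;
     -p.1 0, 0, p.2 2, -p.2 1;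
     -p.1 1, -p.2 2, 0, p.2 0;
     -p.1 2, p.2 1, -p.2 0, 0]

lemma continuous_skewFour : Continuous skewFour := by
  refine continuous_matrix fun i j => ?_
  fin_cases i <;> fin_cases j <;> simp [skewFour] <;> fun_prop

lemma IsQSOMatrix.eq_skewFour {A : Matrix (Fin 4) (Fin 4) ℝ} (hA : IsQSOMatrix A) :
    A = skewFour (![A 0 1, A 0 2, A 0 3], ![A 2 3, -A 1 3, A 1 2]) := by
  ext i j
  fin_cases i <;> fin_cases j <;> simp [skewFour, hA.apply_self] <;> exact hA.apply_swap _ _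

lemma isQSOMatrix_skewFour {p : (Fin 3 → ℝ) × (Fin 3 → ℝ)} (h₁ : ∀ k, |p.1 k| ≤ 1)
    (h₂ : ∀ k, |p.2 k| ≤ 1) : IsQSOMatrix (skewFour p) := by
  constructor
  · ext i j
    fin_cases i <;> fin_cases j <;> simp [skewFour]
  · intro i j
    fin_cases i <;> fin_cases j <;> simp [skewFour, h₁, h₂]

lemma skewFour_mulVec_eq_zero {p : (Fin 3 → ℝ) × (Fin 3 → ℝ)} (hp : p.1 ⬝ᵥ p.2 ≠ 0)
    {z : Fin 4 → ℝ} (hz : skewFour p *ᵥ z = 0) : z = 0 := by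
  have e : ∀ i, (skewFour p *ᵥ z) i = 0 := congr_fun hz
  have e0 := e 0
  have e1 := e 1
  have e2 := e 2
  have e3 := e 3
  simp [skewFour, mulVec, dotProduct, Fin.sum_univ_four] at e0 e1 e2 e3
  simp only [dotProduct, Fin.sum_univ_three] at hp
  ext i
  refine (mul_eq_zero.1 (?_ : _ * z i = 0)).resolve_left hp
  fin_cases i <;> simp only [Fin.zero_eta, Fin.mk_one, Fin.reduceFinMk]
  · linear_combination -p.2 0 * e1 - p.2 1 * e2 - p.2 2 * e3
  · linear_combination p.2 0 * e0 - p.1 2 * e2 + p.1 1 * e3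
  · linear_combination p.2 1 * e0 + p.1 2 * e1 - p.1 0 * e3
  · linear_combination p.2 2 * e0 - p.1 1 * e1 + p.1 0 * e2

lemma isTransversal_skewFour {p : (Fin 3 → ℝ) × (Fin 3 → ℝ)} (h₁ : ∀ k, p.1 k ≠ 0)
    (h₂ : ∀ k, p.2 k ≠ 0) (hp : p.1 ⬝ᵥ p.2 ≠ 0) : IsTransversal (skewFour p) := by
  refine isTransversal_iff.2 fun s hs z hz hk => ?_
  have hle := Finset.card_le_univ s
  rw [Fintype.card_fin] at hle
  have hcard : s.card = 0 ∨ s.card = 2 ∨ s.card = 4 := by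
    obtain ⟨r, hr⟩ := hs
    omega
  rcases hcard with h | h | h
  · rw [Finset.card_eq_zero] at h
    ext k
    exact hz k (by simp [h])
  · obtain ⟨i, j, hij, rfl⟩ := Finset.card_eq_two.1 h
    have hne : ∀ a b, a ≠ b → skewFour p a b ≠ 0 := fun a b hab => by
      fin_cases a <;> fin_cases b <;> simp_all [skewFour]
    have hself : ∀ a, skewFour p a a = 0 := fun a => by fin_cases a <;> simp [skewFour]
    have hmul : ∀ l, (skewFour p *ᵥ z) l = skewFour p l i * z i + skewFour p l j * z j := by
      intro l
      rw [← Finset.sum_pair hij (f := fun m => skewFour p l m * z m)]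
      exact (Finset.sum_subset (f := fun m => skewFour p l m * z m) (Finset.subset_univ _)
        fun m _ hm => by simp only [hz m hm, mul_zero]).symm
    have ei := hk i (by simp)
    have ej := hk j (by simp)
    rw [hmul, hself, zero_mul, zero_add] at ei
    rw [hmul, hself, zero_mul, add_zero] at ej
    ext l
    by_cases hl : l ∈ ({i, j} : Finset (Fin 4))
    · simp only [Finset.mem_insert, Finset.mem_singleton] at hl
      rcases hl with rfl | rfl
      · exact (mul_eq_zero.1 ej).resolve_left (hne _ _ hij.symm)
      · exact (mul_eq_zero.1 ei).resolve_left (hne _ _ hij)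
    · exact hz l hl
  · have hu : s = Finset.univ := Finset.eq_univ_of_card s (by simpa using h)
    exact skewFour_mulVec_eq_zero hp (funext fun k => hk k (by simp [hu]))

lemma IsTransversal.pfaffian_ne_zero {A : Matrix (Fin 4) (Fin 4) ℝ} (hA : IsQSOMatrix A)
    (hT : IsTransversal A) : A 0 1 * A 2 3 + A 0 3 * A 1 2 - A 0 2 * A 1 3 ≠ 0 := by
  intro h
  have hz := isTransversal_iff.1 hT Finset.univ (by decide) ![0, A 2 3, -A 1 3, A 1 2]
    (fun k hk => absurd (Finset.mem_univ k) hk) (fun k _ => by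
      simp only [mulVec, dotProduct, Fin.sum_univ_four]
      fin_cases k <;> simp [hA.apply_self]
      · linear_combination h
      · ring
      · rw [hA.apply_swap 1 2]; ring
      · rw [hA.apply_swap 1 3, hA.apply_swap 2 3]; ring)
  exact hT.apply_ne_zero_s5 hA (by decide : (2 : Fin 4) ≠ 3) (by simpa using congr_fun hz 1)

/-- Parameters in the unit cube whose coordinates and pfaffian have the same signs as those
of `p`. -/
def signCell (p : (Fin 3 → ℝ) × (Fin 3 → ℝ)) : Set ((Fin 3 → ℝ) × (Fin 3 → ℝ)) :=
  {q | (∀ k, |q.1 k| ≤ 1 ∧ 0 < q.1 k * p.1 k) ∧ (∀ k, |q.2 k| ≤ 1 ∧ 0 < q.2 k * p.2 k) ∧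
    0 < (q.1 ⬝ᵥ q.2) * (p.1 ⬝ᵥ p.2)}

lemma convex_coord (b : ℝ) : Convex ℝ {a : ℝ | |a| ≤ 1 ∧ 0 < a * b} := by
  have h₁ : Convex ℝ {a : ℝ | |a| ≤ 1} := by
    simpa [Set.Icc, abs_le] using convex_Icc (-1 : ℝ) 1
  exact h₁.inter (convex_halfSpace_gt (f := fun a => a * b)
    ⟨fun x y => add_mul x y b, fun c x => by simp [mul_assoc]⟩ 0)

lemma convex_signCell_fiber (p : (Fin 3 → ℝ) × (Fin 3 → ℝ)) (w : Fin 3 → ℝ) :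
    Convex ℝ {v | (v, w) ∈ signCell p} := by
  intro v hv v' hv' a b ha hb hab
  refine ⟨fun k => convex_coord _ (hv.1 k) (hv'.1 k) ha hb hab, hv.2.1, ?_⟩
  exact convex_halfSpace_gt (f := fun v => (v ⬝ᵥ w) * (p.1 ⬝ᵥ p.2))
    ⟨fun x y => by rw [add_dotProduct, add_mul], fun c x => by
      rw [smul_dotProduct, smul_eq_mul, smul_eq_mul, mul_assoc]⟩ 0 hv.2.2 hv'.2.2 ha hb hab

lemma joinedIn_signCell_fiber {p : (Fin 3 → ℝ) × (Fin 3 → ℝ)} {v v' w : Fin 3 → ℝ}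
    (h : (v, w) ∈ signCell p) (h' : (v', w) ∈ signCell p) :
    JoinedIn (signCell p) (v, w) (v', w) := by
  have hj := JoinedIn.of_segment_subset
    ((convex_signCell_fiber p w).segment_subset (show v ∈ _ from h) (show v' ∈ _ from h'))
  refine (hj.map (f := fun u => (u, w)) (by fun_prop)).mono ?_
  rintro _ ⟨u, hu, rfl⟩
  exact hu

/-- A lift of the parameter `w` to a point of `signCell p`: each summand of the pfaffian of `p`
is multiplied by the same positive number. -/
def signCellLift (p : (Fin 3 → ℝ) × (Fin 3 → ℝ)) (w : Fin 3 → ℝ) :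
    (Fin 3 → ℝ) × (Fin 3 → ℝ) :=
  (fun k => p.1 k * p.2 k * (w k * (∏ j ∈ Finset.univ.erase k, w j) ^ 2), w)

lemma signCellLift_mem {p : (Fin 3 → ℝ) × (Fin 3 → ℝ)} (hp : p ∈ signCell p)
    {w : Fin 3 → ℝ} (hw : ∀ k, |w k| ≤ 1 ∧ 0 < w k * p.2 k) :
    signCellLift p w ∈ signCell p := by
  have hw0 : ∀ k, w k ≠ 0 := fun k => left_ne_zero_of_mul (hw k).2.ne'
  refine ⟨fun k => ⟨?_, ?_⟩, hw, ?_⟩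
  · have hprod : |∏ j ∈ Finset.univ.erase k, w j| ≤ 1 := by
      rw [Finset.abs_prod]
      exact Finset.prod_le_one (fun _ _ => abs_nonneg _) fun j _ => (hw j).1
    simp only [signCellLift, abs_mul, abs_pow]
    exact mul_le_one₀ (mul_le_one₀ (hp.1 k).1 (abs_nonneg _) (hp.2.1 k).1) (by positivity)
      (mul_le_one₀ (hw k).1 (by positivity) (pow_le_one₀ (abs_nonneg _) hprod))
  · have hprod : 0 < (∏ j ∈ Finset.univ.erase k, w j) ^ 2 :=
      sq_pos_of_ne_zero (Finset.prod_ne_zero_iff.2 fun j _ => hw0 j)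
    have := mul_pos (mul_pos (hp.1 k).2 (hw k).2) hprod
    simp only [signCellLift]
    linarith
  · have hdot : (signCellLift p w).1 ⬝ᵥ (signCellLift p w).2 = (∏ j, w j) ^ 2 * (p.1 ⬝ᵥ p.2) := by
      simp only [signCellLift, dotProduct, Finset.mul_sum]
      refine Finset.sum_congr rfl fun k _ => ?_
      rw [← Finset.mul_prod_erase Finset.univ w (Finset.mem_univ k)]
      ring
    have hprod : (∏ j, w j) ≠ 0 := Finset.prod_ne_zero_iff.2 fun j _ => hw0 j
    rw [hdot, mul_assoc]
    exact mul_pos (by positivity) hp.2.2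

lemma joinedIn_signCell {p q : (Fin 3 → ℝ) × (Fin 3 → ℝ)} (hp : p ∈ signCell p)
    (hq : q ∈ signCell p) : JoinedIn (signCell p) p q := by
  have hbase : Convex ℝ {w : Fin 3 → ℝ | ∀ k, |w k| ≤ 1 ∧ 0 < w k * p.2 k} :=
    fun w hw w' hw' a b ha hb hab k => convex_coord _ (hw k) (hw' k) ha hb hab
  have hj := JoinedIn.of_segment_subset
    (hbase.segment_subset (show p.2 ∈ _ from hp.2.1) (show q.2 ∈ _ from hq.2.1))
  have hcont : Continuous (signCellLift p) := by
    unfold signCellLift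
    fun_prop
  have hlift : JoinedIn (signCell p) (signCellLift p p.2) (signCellLift p q.2) := by
    refine (hj.map hcont).mono ?_
    rintro _ ⟨w, hw, rfl⟩
    exact signCellLift_mem hp hw
  exact ((joinedIn_signCell_fiber (w := p.2) hp (signCellLift_mem hp hp.2.1)).trans hlift).trans
    (joinedIn_signCell_fiber (w := q.2) (signCellLift_mem hp hq.2.1) hq)

lemma skewFour_mul_pos {p q : (Fin 3 → ℝ) × (Fin 3 → ℝ)} (hq : q ∈ signCell p) {i j : Fin 4}
    (hij : i ≠ j) : 0 < skewFour p i j * skewFour q i j := by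
  have h₁ : ∀ k, 0 < p.1 k * q.1 k := fun k => mul_comm (q.1 k) _ ▸ (hq.1 k).2
  have h₂ : ∀ k, 0 < p.2 k * q.2 k := fun k => mul_comm (q.2 k) _ ▸ (hq.2.1 k).2
  fin_cases i <;> fin_cases j <;> simp [skewFour, h₁, h₂] at hij ⊢

/-- A continuous function without zeros on `[0, 1]` has the same sign at both endpoints. -/
lemma mul_pos_of_continuousOn_ne_zero {f : ℝ → ℝ} (hf : ContinuousOn f (Set.Icc 0 1))
    (h : ∀ t ∈ Set.Icc (0 : ℝ) 1, f t ≠ 0) : 0 < f 0 * f 1 := by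
  by_contra! hle
  have h01 : (0 : ℝ) ∈ Set.uIcc (f 0) (f 1) := by
    rw [Set.mem_uIcc]
    rcases mul_nonpos_iff.1 hle with h | h
    · exact Or.inr h.symm
    · exact Or.inl h
  rw [← Set.uIcc_of_le zero_le_one] at hf h
  obtain ⟨t, ht, h0⟩ := intermediate_value_uIcc hf h01
  exact h t ht h0

end DimFour

theorem homotopic_iff_dim_four (A₀ A₁ : Matrix (Fin 4) (Fin 4) ℝ)
    (h₀ : IsQSOMatrix A₀) (h₁ : IsQSOMatrix A₁)
    (t₀ : IsTransversal A₀) (t₁ : IsTransversal A₁) :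
    QSOHomotopic A₀ A₁ ↔
      ((∀ i j : Fin 4, i < j → A₀ i j * A₁ i j > 0) ∧
        (A₀ 0 1 * A₀ 2 3 + A₀ 0 3 * A₀ 1 2 - A₀ 0 2 * A₀ 1 3) *
        (A₁ 0 1 * A₁ 2 3 + A₁ 0 3 * A₁ 1 2 - A₁ 0 2 * A₁ 1 3) > 0) := by
  constructor
  · rintro ⟨A, hc, rfl, rfl, hA, -, -⟩
    have hentry : ∀ i j, ContinuousOn (fun t => A t i j) (Set.Icc 0 1) := fun i j =>
      (continuous_id.matrix_elem i j).comp_continuousOn hc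
    refine ⟨fun i j hij => mul_pos_of_continuousOn_ne_zero (hentry i j) fun t ht =>
      (hA t ht).2.apply_ne_zero_s5 (hA t ht).1 hij.ne, ?_⟩
    exact mul_pos_of_continuousOn_ne_zero
      (f := fun t => A t 0 1 * A t 2 3 + A t 0 3 * A t 1 2 - A t 0 2 * A t 1 3)
      ((((hentry 0 1).mul (hentry 2 3)).add ((hentry 0 3).mul (hentry 1 2))).sub
        ((hentry 0 2).mul (hentry 1 3)))
      fun t ht => (hA t ht).2.pfaffian_ne_zero (hA t ht).1
  · rintro ⟨hs, hpf⟩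
    set p : (Fin 3 → ℝ) × (Fin 3 → ℝ) :=
      (![A₀ 0 1, A₀ 0 2, A₀ 0 3], ![A₀ 2 3, -A₀ 1 3, A₀ 1 2]) with hp
    set q : (Fin 3 → ℝ) × (Fin 3 → ℝ) :=
      (![A₁ 0 1, A₁ 0 2, A₁ 0 3], ![A₁ 2 3, -A₁ 1 3, A₁ 1 2]) with hq
    have hpA : A₀ = skewFour p := h₀.eq_skewFour
    have hqA : A₁ = skewFour q := h₁.eq_skewFour
    have hpos : ∀ i j : Fin 4, i < j → 0 < A₁ i j * A₀ i j := fun i j hij =>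
      mul_comm (A₀ i j) _ ▸ hs i j hij
    have hself : ∀ i j : Fin 4, i ≠ j → A₀ i j ≠ 0 := fun i j hij => t₀.apply_ne_zero_s5 h₀ hij
    have hpp : p ∈ signCell p := by
      refine ⟨fun k => ⟨?_, mul_self_pos.2 ?_⟩, fun k => ⟨?_, mul_self_pos.2 ?_⟩,
        mul_self_pos.2 ?_⟩
      · fin_cases k <;> simp [hp, h₀.2]
      · fin_cases k <;> simp [hp, hself]
      · fin_cases k <;> simp [hp, h₀.2]
      · fin_cases k <;> simp [hp, hself]
      · intro h
        refine t₀.pfaffian_ne_zero h₀ ?_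
        simp [hp, dotProduct, Fin.sum_univ_three] at h
        linarith
    have hqp : q ∈ signCell p := by
      refine ⟨fun k => ⟨?_, ?_⟩, fun k => ⟨?_, ?_⟩, ?_⟩
      · fin_cases k <;> simp [hq, h₁.2]
      · fin_cases k <;> simp [hp, hq, hpos]
      · fin_cases k <;> simp [hq, h₁.2]
      · fin_cases k <;> simp [hp, hq, hpos]
      · simp [hp, hq, dotProduct, Fin.sum_univ_three]
        linarith
    obtain ⟨γ, hγ⟩ := joinedIn_signCell hpp hqp
    have hmem : ∀ t, γ.extend t ∈ signCell p := fun t => by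
      obtain ⟨s, hs⟩ := γ.extend_range ▸ Set.mem_range_self (f := γ.extend) t
      exact hs ▸ hγ s
    have hQ : ∀ t, IsQSOMatrix (skewFour (γ.extend t)) := fun t =>
      isQSOMatrix_skewFour (fun k => ((hmem t).1 k).1) fun k => ((hmem t).2.1 k).1
    have hT : ∀ t, IsTransversal (skewFour (γ.extend t)) := fun t =>
      isTransversal_skewFour (fun k => left_ne_zero_of_mul ((hmem t).1 k).2.ne')
        (fun k => left_ne_zero_of_mul ((hmem t).2.1 k).2.ne')
        (left_ne_zero_of_mul (hmem t).2.2.ne')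
    have hcard : ∀ r ∈ signCell p, IsQSOMatrix (skewFour r) → IsTransversal (skewFour r) →
        (FixSet A₀).ncard = (FixSet (skewFour r)).ncard := fun r hr hr₁ hr₂ =>
      ncard_fixSet_eq h₀ hr₁ t₀ hr₂ fun i j hij => by
        rw [hpA]; exact skewFour_mul_pos hr hij
    refine ⟨fun t => skewFour (γ.extend t),
      (continuous_skewFour.comp γ.continuous_extend).continuousOn, ?_, ?_,
      fun t _ => ⟨hQ t, hT t⟩, fun t _ => (hcard _ (hmem t) (hQ t) (hT t)).symm, ?_⟩
    · simp only [γ.extend_zero]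
      exact hpA.symm
    · simp only [γ.extend_one]
      exact hqA.symm
    · rw [hqA] at h₁ t₁ ⊢
      exact hcard q hqp h₁ t₁
end

section
/- Let A₀, A₁ be transversal real skew-symmetric m×m matrices with entries of absolute value ≤ 1. If V_{A₀} and V_{A₁} are homotopic, then for every nonempty subset α ⊆ {1,…,m} the Volterra operators V_{(A₀)_α} and V_{(A₁)_α} of the principal submatrices of A₀ and A₁ on the indices in α (i.e. the restrictions of V_{A₀} and V_{A₁} to the face Γ_α) are homotopic as Volterra operators on the simplex S^{|α|−1}. -/
open Matrix

/-- The principal submatrix of `A` on the index set `α`, corresponding to the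
restriction of the Volterra operator `V_A` to the face `Γ_α`. -/
def restrictM {m : ℕ} (A : Matrix (Fin m) (Fin m) ℝ) (α : Finset (Fin m)) :
    Matrix α α ℝ :=
  A.submatrix (fun i => (i : Fin m)) (fun i => (i : Fin m))

section

variable {n : Type*} [Fintype n]

/-- The support of a vector, as a finset. -/
noncomputable def vecSupport (x : n → ℝ) : Finset n := {i | x i ≠ 0}

lemma mem_vecSupport {x : n → ℝ} {i : n} : i ∈ vecSupport x ↔ x i ≠ 0 := by
  simp [vecSupport]

lemma dotProduct_mulVec_self_of_skew {A : Matrix n n ℝ} (hA : Aᵀ = -A) (y : n → ℝ) :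
    y ⬝ᵥ (A *ᵥ y) = 0 := by
  have h : y ⬝ᵥ (A *ᵥ y) = -(y ⬝ᵥ (A *ᵥ y)) := by
    conv_lhs => rw [dotProduct_mulVec, ← mulVec_transpose, hA, neg_mulVec, neg_dotProduct,
      dotProduct_comm]
  linarith

lemma mulVec_apply_eq_sum_of_support {A : Matrix n n ℝ} {x : n → ℝ} {s : Finset n}
    (hx : ∀ i, i ∉ s → x i = 0) (k : n) : (A *ᵥ x) k = ∑ i : s, A k i * x i := by
  rw [Finset.sum_coe_sort s (fun i => A k i * x i)]
  exact (Finset.sum_subset (Finset.subset_univ s)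
    (fun i _ hi => by rw [hx i hi, mul_zero])).symm

variable [DecidableEq n]

lemma IsTransversal.eq_zero {A : Matrix n n ℝ} (hA : IsTransversal A) {s : Finset n}
    (hs : Even s.card) {x : n → ℝ} (hx : ∀ i, i ∉ s → x i = 0)
    (hk : ∀ k ∈ s, (A *ᵥ x) k = 0) : x = 0 := by
  have h := Matrix.eq_zero_of_mulVec_eq_zero (hA s hs) (v := fun i : s => x i) (by
    ext k
    exact (mulVec_apply_eq_sum_of_support hx k).symm.trans (hk k k.2))
  ext i
  by_cases hi : i ∈ s
  · exact congrFun h ⟨i, hi⟩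
  · exact hx i hi

lemma IsTransversal.not_even_card_support {A : Matrix n n ℝ} (hA : IsTransversal A)
    {x : n → ℝ} (hx : x ∈ FixSet A) : ¬ Even (vecSupport x).card := by
  intro hs
  rw [mem_fixSet_iff] at hx
  have h := hA.eq_zero hs (x := x) (fun i hi => by simpa [mem_vecSupport] using hi)
    (fun k hk => hx.2 k (mem_vecSupport.1 hk))
  have h1 := hx.1.2
  simp [h] at h1

lemma exists_mem_even_card_erase {ι : Type*} [DecidableEq ι] {s : Finset ι} (hs : ¬ Even s.card) :
    ∃ i ∈ s, Even (s.erase i).card := by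
  have hne : s.Nonempty := by
    rw [Finset.nonempty_iff_ne_empty]
    rintro rfl
    simp at hs
  obtain ⟨i, hi⟩ := hne
  refine ⟨i, hi, ?_⟩
  rw [Finset.card_erase_of_mem hi]
  exact Nat.Odd.sub_odd (Nat.not_even_iff_odd.1 hs) odd_one

/-- Vectors supported in `s` and annihilated by `A` on `s` are proportional
when `s.erase i` has even cardinality. -/
lemma IsTransversal.smul_eq_smul {A : Matrix n n ℝ} (hA : IsTransversal A) {s : Finset n} {i : n}
    (hs : Even (s.erase i).card) {x z : n → ℝ}
    (hx : ∀ j, j ∉ s → x j = 0) (hz : ∀ j, j ∉ s → z j = 0)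
    (hkx : ∀ k ∈ s, (A *ᵥ x) k = 0) (hkz : ∀ k ∈ s, (A *ᵥ z) k = 0) :
    z i • x = x i • z := by
  rw [← sub_eq_zero]
  refine hA.eq_zero hs (fun j hj => ?_) (fun k hk => ?_)
  · by_cases hji : j = i
    · subst hji
      simp [mul_comm]
    · have : j ∉ s := fun h => hj (Finset.mem_erase.2 ⟨hji, h⟩)
      simp [hx j this, hz j this]
  · have hk' := Finset.mem_of_mem_erase hk
    simp [mulVec_sub, mulVec_smul, hkx k hk', hkz k hk']

lemma IsTransversal.injOn_vecSupport {A : Matrix n n ℝ} (hA : IsTransversal A) :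
    Set.InjOn vecSupport (FixSet A) := by
  intro x hx z hz hxz
  obtain ⟨i, hi, he⟩ := exists_mem_even_card_erase (hA.not_even_card_support hx)
  rw [mem_fixSet_iff] at hx hz
  have h := hA.smul_eq_smul he (x := x) (z := z)
    (fun j hj => by simpa [mem_vecSupport] using hj)
    (fun j hj => by rw [hxz] at hj; simpa [mem_vecSupport] using hj)
    (fun k hk => hx.2 k (mem_vecSupport.1 hk))
    (fun k hk => by rw [hxz] at hk; exact hz.2 k (mem_vecSupport.1 hk))
  have hsum : z i = x i := by
    have := congrArg (fun v : n → ℝ => ∑ j, v j) h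
    simpa [← Finset.mul_sum, hx.1.2, hz.1.2] using this
  rw [hsum] at h
  exact smul_right_injective _ (mem_vecSupport.1 hi) h

/-- The vector equal to `1` at `i`, supported in `insert i s`, and annihilated by `A` on `s`. -/
noncomputable def kernelVec (A : Matrix n n ℝ) (s : Finset n) (i : n) : n → ℝ := fun j =>
  if h : j ∈ s then
    -((A.submatrix (fun k : s => (k : n)) (fun k : s => (k : n)))⁻¹ *ᵥ (fun k : s => A k i)) ⟨j, h⟩
  else if j = i then 1 else 0

lemma continuous_kernelVec {X : Type*} [TopologicalSpace X] {A : X → Matrix n n ℝ}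
    (hc : Continuous A) (hA : ∀ t, IsTransversal (A t)) {s : Finset n} (hs : Even s.card)
    (i j : n) :
    Continuous fun t => kernelVec (A t) s i j := by
  unfold kernelVec
  split_ifs with h
  · have hsub : Continuous fun t =>
        (A t).submatrix (fun k : s => (k : n)) (fun k : s => (k : n)) := hc.matrix_submatrix _ _
    have hinv : Continuous fun t =>
        ((A t).submatrix (fun k : s => (k : n)) (fun k : s => (k : n)))⁻¹ := by
      simp only [Matrix.inv_def, Ring.inverse_eq_inv']
      exact (hsub.matrix_det.inv₀ fun t => hA t s hs).smul hsub.matrix_adjugate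
    have hcol : Continuous fun t => (fun k : s => A t k i) :=
      continuous_pi fun k => hc.matrix_elem _ _
    exact ((continuous_apply _).comp (hinv.matrix_mulVec hcol)).neg
  · exact continuous_const
  · exact continuous_const

lemma kernelVec_self {ι : Type*} [DecidableEq ι] (A : Matrix ι ι ℝ) {s : Finset ι} {i : ι} (hi : i ∉ s) :
    kernelVec A s i i = 1 := by
  simp [kernelVec, hi]

lemma kernelVec_of_notMem {ι : Type*} [DecidableEq ι] (A : Matrix ι ι ℝ) {s : Finset ι} {i j : ι}
    (hj : j ∉ insert i s) :
    kernelVec A s i j = 0 := by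
  rw [Finset.mem_insert, not_or] at hj
  simp [kernelVec, hj.1, hj.2]

lemma mulVec_kernelVec {A : Matrix n n ℝ} (hskew : Aᵀ = -A) (hA : IsTransversal A) {s : Finset n}
    (hs : Even s.card) {i : n} (hi : i ∉ s) {k : n} (hk : k ∈ insert i s) :
    (A *ᵥ kernelVec A s i) k = 0 := by
  have hmem : ∀ k ∈ s, (A *ᵥ kernelVec A s i) k = 0 := by
    intro k hk
    rw [mulVec_apply_eq_sum_of_support (s := insert i s)
      (fun j hj => kernelVec_of_notMem A hj),
      Finset.sum_coe_sort (insert i s) (fun j => A k j * kernelVec A s i j),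
      Finset.sum_insert hi, kernelVec_self A hi,
      ← Finset.sum_coe_sort s (fun j => A k j * kernelVec A s i j)]
    have hval : ∀ j : s, kernelVec A s i j =
        -((A.submatrix (fun k : s => (k : n)) (fun k : s => (k : n)))⁻¹ *ᵥ
          (fun k : s => A k i)) j := fun j => by simp [kernelVec]
    have hmul : (A.submatrix (fun k : s => (k : n)) (fun k : s => (k : n))) *ᵥ
        ((A.submatrix (fun k : s => (k : n)) (fun k : s => (k : n)))⁻¹ *ᵥ
          (fun k : s => A k i)) = fun k : s => A k i := by
      rw [mulVec_mulVec, Matrix.mul_nonsing_inv _ (isUnit_iff_ne_zero.2 (hA s hs)), one_mulVec]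
    have hrow := congrFun hmul ⟨k, hk⟩
    rw [mulVec, dotProduct] at hrow
    simp only [submatrix_apply] at hrow
    simp only [hval, mul_neg, Finset.sum_neg_distrib, hrow, mul_one, add_neg_cancel]
  rcases Finset.mem_insert.1 hk with rfl | hk
  · have h := dotProduct_mulVec_self_of_skew hskew (kernelVec A s k)
    rw [dotProduct, Finset.sum_eq_single k, kernelVec_self A hi, one_mul] at h
    · exact h
    · intro j _ hj
      by_cases hjs : j ∈ s
      · rw [hmem j hjs, mul_zero]
      · rw [kernelVec_of_notMem A (by simp [hj, hjs]), zero_mul]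
    · simp
  · exact hmem k hk

lemma kernelVec_ne_zero {A : Matrix n n ℝ} (hskew : Aᵀ = -A) (hA : IsTransversal A) {s : Finset n}
    (hs : Even s.card) {i : n} (hi : i ∉ s) {j : n} (hj : j ∈ insert i s) :
    kernelVec A s i j ≠ 0 := by
  intro h0
  have hcard : Even ((insert i s).erase j).card := by
    rwa [Finset.card_erase_of_mem hj, Finset.card_insert_of_notMem hi, Nat.add_sub_cancel]
  have h := hA.eq_zero hcard (x := kernelVec A s i) (fun k hk => by
      by_cases hkj : k = j
      · rw [hkj, h0]
      · exact kernelVec_of_notMem A fun hk' => hk (Finset.mem_erase.2 ⟨hkj, hk'⟩))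
    (fun k hk => mulVec_kernelVec hskew hA hs hi (Finset.mem_of_mem_erase hk))
  simpa [kernelVec_self A hi] using congrFun h i

lemma pos_of_continuous_of_ne_zero {X : Type*} [TopologicalSpace X] [PreconnectedSpace X]
    {f : X → ℝ} (hf : Continuous f) (h0 : ∀ t, f t ≠ 0) {a : X} (ha : 0 < f a) (b : X) :
    0 < f b := by
  by_contra hb
  obtain ⟨t, ht⟩ := mem_range_of_exists_le_of_exists_ge hf ⟨b, not_lt.1 hb⟩ ⟨a, ha.le⟩
  exact h0 t ht

/-- The supports of fixed points persist along a continuous transversal family. -/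
lemma image_vecSupport_fixSet_subset {X : Type*} [TopologicalSpace X] [PreconnectedSpace X]
    {A : X → Matrix n n ℝ} (hc : Continuous A) (hskew : ∀ t, (A t)ᵀ = -A t)
    (hA : ∀ t, IsTransversal (A t)) (a b : X) :
    vecSupport '' FixSet (A a) ⊆ vecSupport '' FixSet (A b) := by
  rintro _ ⟨x, hx, rfl⟩
  obtain ⟨i, hi, he⟩ := exists_mem_even_card_erase ((hA a).not_even_card_support hx)
  rw [mem_fixSet_iff] at hx
  set s := (vecSupport x).erase i
  have his : i ∉ s := Finset.notMem_erase _ _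
  have hins : insert i s = vecSupport x := Finset.insert_erase hi
  have hxpos : ∀ j ∈ vecSupport x, 0 < x j := fun j hj =>
    (hx.1.1 j).lt_of_ne' (mem_vecSupport.1 hj)
  have hprop : x i • kernelVec (A a) s i = x := by
    have := (hA a).smul_eq_smul he (x := kernelVec (A a) s i) (z := x)
      (fun j hj => kernelVec_of_notMem _ (hins ▸ hj))
      (fun j hj => by simpa [mem_vecSupport] using hj)
      (fun k hk => mulVec_kernelVec (hskew a) (hA a) he his (hins ▸ hk))
      (fun k hk => hx.2 k (mem_vecSupport.1 hk))
    rwa [kernelVec_self _ his, one_smul] at this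
  have hpos : ∀ j ∈ vecSupport x, 0 < kernelVec (A b) s i j := by
    intro j hj
    refine pos_of_continuous_of_ne_zero (continuous_kernelVec hc hA he i j)
      (fun t => kernelVec_ne_zero (hskew t) (hA t) he his (hins ▸ hj)) (a := a) ?_ b
    have h := hxpos j hj
    rw [← hprop] at h
    exact pos_of_mul_pos_right h (hxpos i hi).le
  have hzero : ∀ j ∉ vecSupport x, kernelVec (A b) s i j = 0 := fun j hj =>
    kernelVec_of_notMem _ (hins ▸ hj)
  have hnonneg : ∀ j, 0 ≤ kernelVec (A b) s i j := fun j => by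
    by_cases hj : j ∈ vecSupport x
    · exact (hpos j hj).le
    · exact (hzero j hj).ge
  have hsum : 0 < ∑ j, kernelVec (A b) s i j :=
    Finset.sum_pos' (fun j _ => hnonneg j) ⟨i, Finset.mem_univ i, hpos i hi⟩
  have hsupp : vecSupport ((∑ j, kernelVec (A b) s i j)⁻¹ • kernelVec (A b) s i) =
      vecSupport x := by
    ext j
    by_cases hj : j ∈ vecSupport x
    · simpa [hj, mem_vecSupport, hsum.ne'] using (hpos j hj).ne'
    · simp [hj, mem_vecSupport, hzero j hj]
  refine ⟨(∑ j, kernelVec (A b) s i j)⁻¹ • kernelVec (A b) s i,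
    mem_fixSet_iff.2 ⟨⟨fun j => mul_nonneg (inv_nonneg.2 hsum.le) (hnonneg j), ?_⟩,
    fun k hk => ?_⟩, hsupp⟩
  · simp only [Pi.smul_apply, smul_eq_mul, ← Finset.mul_sum]
    exact inv_mul_cancel₀ hsum.ne'
  · replace hk := mem_vecSupport.2 hk
    rw [hsupp, ← hins] at hk
    rw [mulVec_smul, Pi.smul_apply, mulVec_kernelVec (hskew b) (hA b) he his hk, smul_zero]

/-- The number of fixed points is constant along a continuous transversal family. -/
lemma ncard_fixSet_eq_s9 {X : Type*} [TopologicalSpace X] [PreconnectedSpace X]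
    {A : X → Matrix n n ℝ} (hc : Continuous A) (hskew : ∀ t, (A t)ᵀ = -A t)
    (hA : ∀ t, IsTransversal (A t)) (a b : X) :
    (FixSet (A a)).ncard = (FixSet (A b)).ncard := by
  rw [← (hA a).injOn_vecSupport.ncard_image, ← (hA b).injOn_vecSupport.ncard_image,
    (image_vecSupport_fixSet_subset hc hskew hA a b).antisymm
      (image_vecSupport_fixSet_subset hc hskew hA b a)]

end

lemma IsQSOMatrix.restrictM {m : ℕ} {A : Matrix (Fin m) (Fin m) ℝ} (hA : IsQSOMatrix A)
    (α : Finset (Fin m)) : IsQSOMatrix (restrictM A α) :=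
  ⟨by ext i j; exact congrFun (congrFun hA.1 i) j, fun i j => hA.2 i j⟩

lemma IsTransversal.restrictM {m : ℕ} {A : Matrix (Fin m) (Fin m) ℝ} (hA : IsTransversal A)
    (α : Finset (Fin m)) : IsTransversal (restrictM A α) := by
  intro s hs
  have h := hA (s.map (Function.Embedding.subtype _)) (by rwa [Finset.card_map])
  let e : s ≃ s.map (Function.Embedding.subtype (· ∈ α)) :=
    (Equiv.Set.image _ (s : Set α) Subtype.val_injective).trans
      (Equiv.subtypeEquivRight fun i => by simp)
  rw [← Matrix.det_submatrix_equiv_self e] at h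
  exact h

theorem homotopic_restrict_face {m : ℕ} (A₀ A₁ : Matrix (Fin m) (Fin m) ℝ)
    (h₀ : IsQSOMatrix A₀) (h₁ : IsQSOMatrix A₁)
    (t₀ : IsTransversal A₀) (t₁ : IsTransversal A₁)
    (h : QSOHomotopic A₀ A₁) :
    ∀ α : Finset (Fin m), α.Nonempty →
      QSOHomotopic (restrictM A₀ α) (restrictM A₁ α) := by
  intro α _
  obtain ⟨A, hc, rfl, rfl, hA, -, -⟩ := h
  have hcr : Continuous fun t : Set.Icc (0 : ℝ) 1 => restrictM (A t) α :=
    (continuousOn_iff_continuous_domRestrict.1 hc).matrix_submatrix _ _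
  have hcard : ∀ a b : Set.Icc (0 : ℝ) 1,
      (FixSet (restrictM (A a) α)).ncard = (FixSet (restrictM (A b) α)).ncard :=
    ncard_fixSet_eq_s9 hcr (fun t => ((hA t t.2).1.restrictM α).1)
      (fun t => (hA t t.2).2.restrictM α)
  exact ⟨fun t => restrictM (A t) α, continuousOn_iff_continuous_domRestrict.2 hcr, rfl, rfl,
    fun t ht => ⟨(hA t ht).1.restrictM α, (hA t ht).2.restrictM α⟩,
    fun t ht => hcard ⟨t, ht⟩ 0, hcard 0 1⟩
end

section
/- Let A₀, A₁ be transversal real skew-symmetric m×m matrices with entries of absolute value ≤ 1 such that V_{A₀} and V_{A₁} are homotopic. Then for every subset α ⊆ {1,…,m}: (i) the sets Fix(V_{A₀}) ∩ Γ_α and Fix(V_{A₁}) ∩ Γ_α have the same (finite) cardinality; and (ii) the sets Fix(V_{A₀}) ∩ riΓ_α and Fix(V_{A₁}) ∩ riΓ_α have the same cardinality, where riΓ_α = {x ∈ S^{m−1} : x_i > 0 for all i ∈ α and x_i = 0 for all i ∉ α} is the relative interior of the face Γ_α. -/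
open Matrix

/-- The face `Γ_α` of the simplex. -/
def face {m : ℕ} (α : Finset (Fin m)) : Set (Fin m → ℝ) :=
  {x ∈ stdSimplex ℝ (Fin m) | ∀ i ∉ α, x i = 0}

/-- The relative interior `ri Γ_α` of the face `Γ_α`. -/
def riFace {m : ℕ} (α : Finset (Fin m)) : Set (Fin m → ℝ) :=
  {x ∈ stdSimplex ℝ (Fin m) | (∀ i ∈ α, 0 < x i) ∧ ∀ i ∉ α, x i = 0}

theorem IsTransversal.eq_zero_of_mulVec_eq_zero {m : ℕ} {A : Matrix (Fin m) (Fin m) ℝ}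
    (hA : IsTransversal A) {s : Finset (Fin m)} (hs : Even s.card) {x : Fin m → ℝ}
    (hx : ∀ i ∉ s, x i = 0) (hAx : ∀ i ∈ s, (A *ᵥ x) i = 0) : x = 0 := by
  have key := Matrix.eq_zero_of_mulVec_eq_zero (hA s hs) (v := fun i : s => x i) (by
    ext i
    have h := hAx i i.2
    rw [Matrix.mulVec, dotProduct,
      ← Finset.sum_subset s.subset_univ (fun k _ hk => by simp [hx k hk]),
      ← Finset.sum_coe_sort s] at h
    simpa [Matrix.mulVec, dotProduct] using h)
  ext i
  by_cases hi : i ∈ s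
  · exact congrFun key ⟨i, hi⟩
  · exact hx i hi

theorem mem_fixSet_inter_riFace_iff {m : ℕ} {A : Matrix (Fin m) (Fin m) ℝ}
    {α : Finset (Fin m)} {x : Fin m → ℝ} :
    x ∈ FixSet A ∩ riFace α ↔
      x ∈ riFace α ∧ ∀ i ∈ α, (A *ᵥ x) i = 0 := by
  constructor
  · rintro ⟨⟨-, hfix⟩, hri⟩
    refine ⟨hri, fun i hi => ?_⟩
    have h := congrFun hfix i
    have hpos := hri.2.1 i hi
    simp only [volterra] at h
    have : x i * (A *ᵥ x) i = 0 := by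
      simp only [Matrix.mulVec, dotProduct]
      linarith
    exact (mul_eq_zero.mp this).resolve_left hpos.ne'
  · rintro ⟨hri, hker⟩
    refine ⟨⟨hri.1, ?_⟩, hri⟩
    ext i
    by_cases hi : i ∈ α
    · have h := hker i hi
      simp only [Matrix.mulVec, dotProduct] at h
      simp [volterra, h]
    · simp [volterra, hri.2.2 i hi]

theorem riFace.nonempty {m : ℕ} {α : Finset (Fin m)} {x : Fin m → ℝ} (hx : x ∈ riFace α) :
    α.Nonempty := by
  by_contra h
  rw [Finset.not_nonempty_iff_eq_empty] at h
  subst h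
  have h1 := hx.1.2
  simp [hx.2.2] at h1

theorem IsTransversal.odd_card {m : ℕ} {A : Matrix (Fin m) (Fin m) ℝ}
    (hA : IsTransversal A) {α : Finset (Fin m)} {x : Fin m → ℝ}
    (hx : x ∈ FixSet A ∩ riFace α) : Odd α.card := by
  obtain ⟨hri, hker⟩ := mem_fixSet_inter_riFace_iff.mp hx
  by_contra h
  have h0 := hA.eq_zero_of_mulVec_eq_zero (Nat.not_odd_iff_even.mp h) hri.2.2 hker
  obtain ⟨j, hj⟩ := riFace.nonempty hri
  have := hri.2.1 j hj
  simp [h0] at this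

/-- On an index set of odd size, a kernel vector is determined by any one of its coordinates. -/
theorem IsTransversal.smul_eq_smul_s10 {m : ℕ} {A : Matrix (Fin m) (Fin m) ℝ}
    (hA : IsTransversal A) {α : Finset (Fin m)} (hα : Odd α.card) {j : Fin m} (hj : j ∈ α)
    {x y : Fin m → ℝ} (hx : ∀ i ∉ α, x i = 0) (hy : ∀ i ∉ α, y i = 0)
    (hAx : ∀ i ∈ α, (A *ᵥ x) i = 0) (hAy : ∀ i ∈ α, (A *ᵥ y) i = 0) :
    y j • x = x j • y := by
  rw [← sub_eq_zero]
  refine hA.eq_zero_of_mulVec_eq_zero (s := α.erase j) ?_ (fun i hi => ?_) (fun i hi => ?_)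
  · rw [Finset.card_erase_of_mem hj]
    exact hα.tsub_odd odd_one
  · by_cases hij : i = j
    · subst hij
      simp [mul_comm]
    · have : i ∉ α := fun h => hi (Finset.mem_erase.mpr ⟨hij, h⟩)
      simp [hx i this, hy i this]
  · have := Finset.mem_of_mem_erase hi
    simp [Matrix.mulVec_sub, Matrix.mulVec_smul, hAx i this, hAy i this]

theorem IsTransversal.subsingleton_fixSet_inter_riFace {m : ℕ} {A : Matrix (Fin m) (Fin m) ℝ}
    (hA : IsTransversal A) (α : Finset (Fin m)) : (FixSet A ∩ riFace α).Subsingleton := by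
  intro x hx y hy
  have hodd := hA.odd_card hx
  obtain ⟨hxri, hAx⟩ := mem_fixSet_inter_riFace_iff.mp hx
  obtain ⟨hyri, hAy⟩ := mem_fixSet_inter_riFace_iff.mp hy
  obtain ⟨j, hj⟩ := riFace.nonempty hxri
  have h := hA.smul_eq_smul_s10 hodd hj hxri.2.2 hyri.2.2 hAx hAy
  have hsum : y j = x j := by
    have h2 := congrArg (fun v : Fin m → ℝ => ∑ i, v i) h
    simpa [← Finset.mul_sum, hxri.1.2, hyri.1.2] using h2
  rw [hsum] at h
  exact smul_right_injective _ (hxri.2.1 j hj).ne' h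

theorem dotProduct_mulVec_self_eq_zero {n : Type*} [Fintype n] {A : Matrix n n ℝ}
    (hA : Aᵀ = -A) (x : n → ℝ) : x ⬝ᵥ (A *ᵥ x) = 0 := by
  have h : x ⬝ᵥ (A *ᵥ x) = -(x ⬝ᵥ (A *ᵥ x)) := by
    conv_lhs => rw [Matrix.dotProduct_mulVec, ← Matrix.mulVec_transpose, hA, dotProduct_comm,
      Matrix.neg_mulVec, dotProduct_neg]
  linarith

/-- The vector supported on `insert j s` with `j`-th coordinate `1` which is annihilated by the
rows of `A` indexed by `s`. -/
noncomputable def kernelVector {m : ℕ} (A : Matrix (Fin m) (Fin m) ℝ) (s : Finset (Fin m))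
    (j : Fin m) : Fin m → ℝ := fun i =>
  if h : i ∈ s then
    -((A.submatrix (fun i : s => (i : Fin m)) (fun i : s => (i : Fin m)))⁻¹ *ᵥ
      fun k : s => A k j) ⟨i, h⟩
  else if i = j then 1 else 0

theorem kernelVector_self {m : ℕ} (A : Matrix (Fin m) (Fin m) ℝ) {s : Finset (Fin m)}
    {j : Fin m} (hj : j ∉ s) : kernelVector A s j j = 1 := by
  simp [kernelVector, hj]

theorem kernelVector_of_notMem {m : ℕ} (A : Matrix (Fin m) (Fin m) ℝ) {s : Finset (Fin m)}
    {i j : Fin m} (hi : i ∉ s) (hij : i ≠ j) : kernelVector A s j i = 0 := by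
  simp [kernelVector, hi, hij]

theorem mulVec_kernelVector_of_mem {m : ℕ} {A : Matrix (Fin m) (Fin m) ℝ} {s : Finset (Fin m)}
    {i j : Fin m}
    (hdet : (A.submatrix (fun i : s => (i : Fin m)) (fun i : s => (i : Fin m))).det ≠ 0)
    (hj : j ∉ s) (hi : i ∈ s) : (A *ᵥ kernelVector A s j) i = 0 := by
  set M := A.submatrix (fun i : s => (i : Fin m)) (fun i : s => (i : Fin m)) with hM
  have hsolve : M *ᵥ (M⁻¹ *ᵥ fun k : s => A k j) = fun k : s => A k j := by
    rw [Matrix.mulVec_mulVec, Matrix.mul_nonsing_inv _ hdet.isUnit, Matrix.one_mulVec]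
  have hrow := congrFun hsolve ⟨i, hi⟩
  rw [Matrix.mulVec, dotProduct] at hrow
  rw [Matrix.mulVec, dotProduct, ← Finset.sum_subset (insert j s).subset_univ,
    Finset.sum_insert hj, kernelVector_self A hj, ← Finset.sum_coe_sort s]
  · have hcoe : ∀ k : s, A i k * kernelVector A s j k =
        -(M ⟨i, hi⟩ k * (M⁻¹ *ᵥ fun k : s => A k j) k) := by
      intro k
      simp [kernelVector, hM]
    rw [Finset.sum_congr rfl fun k _ => hcoe k, Finset.sum_neg_distrib, hrow]
    ring
  · intro k _ hk
    rw [Finset.mem_insert, not_or] at hk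
    rw [kernelVector_of_notMem A hk.2 hk.1, mul_zero]

theorem mulVec_kernelVector_self {m : ℕ} {A : Matrix (Fin m) (Fin m) ℝ} (hA : Aᵀ = -A)
    {s : Finset (Fin m)} {j : Fin m}
    (hdet : (A.submatrix (fun i : s => (i : Fin m)) (fun i : s => (i : Fin m))).det ≠ 0)
    (hj : j ∉ s) : (A *ᵥ kernelVector A s j) j = 0 := by
  have h := dotProduct_mulVec_self_eq_zero hA (kernelVector A s j)
  rw [dotProduct, Finset.sum_eq_single j] at h
  · simpa [kernelVector_self A hj] using h
  · intro i _ hij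
    by_cases hi : i ∈ s
    · rw [mulVec_kernelVector_of_mem hdet hj hi, mul_zero]
    · rw [kernelVector_of_notMem A hi hij, zero_mul]
  · simp

theorem continuousOn_kernelVector {m : ℕ} {A : ℝ → Matrix (Fin m) (Fin m) ℝ} {I : Set ℝ}
    (hA : ContinuousOn A I) {s : Finset (Fin m)} (j i : Fin m)
    (hdet : ∀ t ∈ I,
      ((A t).submatrix (fun i : s => (i : Fin m)) (fun i : s => (i : Fin m))).det ≠ 0) :
    ContinuousOn (fun t => kernelVector (A t) s j i) I := by
  unfold kernelVector
  split_ifs with hi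
  · have hentry : ∀ k l, ContinuousOn (fun t => A t k l) I := fun k l =>
      (continuous_apply_apply k l).comp_continuousOn hA
    have hM : ContinuousOn (fun t =>
        (A t).submatrix (fun i : s => (i : Fin m)) (fun i : s => (i : Fin m))) I :=
      continuousOn_pi.mpr fun k => continuousOn_pi.mpr fun l => hentry k l
    have hinv : ∀ k l, ContinuousOn (fun t =>
        ((A t).submatrix (fun i : s => (i : Fin m)) (fun i : s => (i : Fin m)))⁻¹ k l) I := by
      intro k l
      simp only [Matrix.inv_def, Ring.inverse_eq_inv', Matrix.smul_apply, smul_eq_mul]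
      exact ((continuous_id.matrix_det.comp_continuousOn hM).inv₀ hdet).mul
        ((continuous_apply_apply k l).comp_continuousOn
          (continuous_id.matrix_adjugate.comp_continuousOn hM))
    simp only [Matrix.mulVec, dotProduct]
    exact (continuousOn_finsetSum _ fun k _ => (hinv _ k).mul (hentry _ _)).neg
  all_goals exact continuousOn_const

theorem pos_of_continuousOn_of_ne_zero {f : ℝ → ℝ} {I : Set ℝ} (hI : IsPreconnected I)
    (hf : ContinuousOn f I) (hne : ∀ t ∈ I, f t ≠ 0) {a b : ℝ} (ha : a ∈ I) (hb : b ∈ I)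
    (hpos : 0 < f a) : 0 < f b := by
  by_contra h
  obtain ⟨t, ht, ht0⟩ := hI.intermediate_value hb ha hf ⟨not_lt.mp h, hpos.le⟩
  exact hne t ht ht0

/-- Along a path of transversal skew-symmetric matrices, the existence of a fixed point in the
relative interior of a given face persists. -/
theorem fixSet_inter_riFace_nonempty_of_path {m : ℕ} {A : ℝ → Matrix (Fin m) (Fin m) ℝ}
    {I : Set ℝ} (hI : IsPreconnected I) (hA : ContinuousOn A I)
    (hskew : ∀ t ∈ I, (A t)ᵀ = -A t) (htr : ∀ t ∈ I, IsTransversal (A t))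
    {a b : ℝ} (ha : a ∈ I) (hb : b ∈ I) {α : Finset (Fin m)}
    (h : (FixSet (A a) ∩ riFace α).Nonempty) : (FixSet (A b) ∩ riFace α).Nonempty := by
  obtain ⟨x, hx⟩ := h
  have hodd := (htr a ha).odd_card hx
  obtain ⟨hri, hker⟩ := mem_fixSet_inter_riFace_iff.mp hx
  obtain ⟨j, hj⟩ := riFace.nonempty hri
  have heven : ∀ i ∈ α, Even (α.erase i).card := fun i hi => by
    rw [Finset.card_erase_of_mem hi]
    exact hodd.tsub_odd odd_one
  have hjs : j ∉ α.erase j := Finset.notMem_erase j α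
  have hdet := fun t ht => htr t ht (α.erase j) (heven j hj)
  set w : ℝ → Fin m → ℝ := fun t => kernelVector (A t) (α.erase j) j
  have hwj : ∀ t, w t j = 1 := fun t => kernelVector_self _ hjs
  have hwout : ∀ t, ∀ i ∉ α, w t i = 0 := fun t i hi =>
    kernelVector_of_notMem _ (fun h => hi (Finset.mem_of_mem_erase h)) (fun h => hi (h ▸ hj))
  have hwker : ∀ t ∈ I, ∀ i ∈ α, (A t *ᵥ w t) i = 0 := by
    intro t ht i hi
    by_cases hij : i = j
    · subst hij
      exact mulVec_kernelVector_self (hskew t ht) (hdet t ht) hjs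
    · exact mulVec_kernelVector_of_mem (hdet t ht) hjs (Finset.mem_erase.mpr ⟨hij, hi⟩)
  have hne : ∀ t ∈ I, ∀ i ∈ α, w t i ≠ 0 := by
    intro t ht i hi h0
    have hzero := (htr t ht).eq_zero_of_mulVec_eq_zero (heven i hi) (x := w t)
      (fun k hk => by
        by_cases hki : k = i
        · rw [hki, h0]
        · exact hwout t k fun h => hk (Finset.mem_erase.mpr ⟨hki, h⟩))
      (fun k hk => hwker t ht k (Finset.mem_of_mem_erase hk))
    have := hwj t
    simp [hzero] at this
  have hposa : ∀ i ∈ α, 0 < w a i := by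
    intro i hi
    have h := congrFun ((htr a ha).smul_eq_smul_s10 hodd hj hri.2.2 (hwout a) hker (hwker a ha)) i
    simp only [hwj, Pi.smul_apply, smul_eq_mul, one_mul] at h
    exact pos_of_mul_pos_right (h ▸ hri.2.1 i hi) (hri.2.1 j hj).le
  have hposb : ∀ i ∈ α, 0 < w b i := fun i hi =>
    pos_of_continuousOn_of_ne_zero hI (continuousOn_kernelVector hA j i hdet)
      (fun t ht => hne t ht i hi) ha hb (hposa i hi)
  have hnonneg : ∀ i, 0 ≤ w b i := fun i => by
    by_cases hi : i ∈ α
    · exact (hposb i hi).le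
    · exact (hwout b i hi).ge
  have hsum : 0 < ∑ i, w b i :=
    Finset.sum_pos' (fun i _ => hnonneg i) ⟨j, Finset.mem_univ j, hposb j hj⟩
  refine ⟨(∑ i, w b i)⁻¹ • w b, mem_fixSet_inter_riFace_iff.mpr ⟨⟨⟨fun i => ?_, ?_⟩,
    fun i hi => ?_, fun i hi => ?_⟩, fun i hi => ?_⟩⟩
  · exact mul_nonneg (inv_nonneg.mpr hsum.le) (hnonneg i)
  · simp [← Finset.mul_sum, hsum.ne']
  · exact mul_pos (inv_pos.mpr hsum) (hposb i hi)
  · simp [hwout b i hi]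
  · simp [Matrix.mulVec_smul, hwker b hb i hi]

/-- The set of indices of the positive coordinates of a vector. -/
noncomputable def posSupport {m : ℕ} (x : Fin m → ℝ) : Finset (Fin m) :=
  Finset.univ.filter fun i => 0 < x i

theorem mem_riFace_posSupport {m : ℕ} {x : Fin m → ℝ} (hx : x ∈ stdSimplex ℝ (Fin m)) :
    x ∈ riFace (posSupport x) :=
  ⟨hx, fun i hi => by simpa [posSupport] using hi,
    fun i hi => le_antisymm (by simpa [posSupport] using hi) (hx.1 i)⟩

theorem posSupport_eq_of_mem_riFace {m : ℕ} {α : Finset (Fin m)} {x : Fin m → ℝ}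
    (hx : x ∈ riFace α) : posSupport x = α := by
  ext i
  by_cases hi : i ∈ α
  · simp [posSupport, hi, hx.2.1 i hi]
  · simp [posSupport, hi, hx.2.2 i hi]

theorem IsTransversal.injOn_posSupport {m : ℕ} {A : Matrix (Fin m) (Fin m) ℝ}
    (hA : IsTransversal A) : Set.InjOn posSupport (FixSet A) := fun x hx _ hy hxy =>
  hA.subsingleton_fixSet_inter_riFace (posSupport x) ⟨hx, mem_riFace_posSupport hx.1⟩
    ⟨hy, hxy ▸ mem_riFace_posSupport hy.1⟩

theorem posSupport_image_fixSet_inter_face {m : ℕ} (A : Matrix (Fin m) (Fin m) ℝ)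
    (α : Finset (Fin m)) :
    posSupport '' (FixSet A ∩ face α) = {β | β ⊆ α ∧ (FixSet A ∩ riFace β).Nonempty} := by
  ext β
  constructor
  · rintro ⟨x, ⟨hfix, hface⟩, rfl⟩
    refine ⟨fun i hi => ?_, x, hfix, mem_riFace_posSupport hfix.1⟩
    by_contra hiα
    exact ((mem_riFace_posSupport hfix.1).2.1 i hi).ne' (hface.2 i hiα)
  · rintro ⟨hβ, x, hfix, hri⟩
    exact ⟨x, ⟨hfix, hfix.1, fun i hi => hri.2.2 i fun h => hi (hβ h)⟩,
      posSupport_eq_of_mem_riFace hri⟩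

theorem homotopic_fixed_points_on_faces {m : ℕ} (A₀ A₁ : Matrix (Fin m) (Fin m) ℝ)
    (h₀ : IsQSOMatrix A₀) (h₁ : IsQSOMatrix A₁)
    (t₀ : IsTransversal A₀) (t₁ : IsTransversal A₁)
    (h : QSOHomotopic A₀ A₁) :
    ∀ α : Finset (Fin m),
      ((FixSet A₀ ∩ face α).Finite ∧
        (FixSet A₀ ∩ face α).ncard = (FixSet A₁ ∩ face α).ncard) ∧
      (FixSet A₀ ∩ riFace α).ncard = (FixSet A₁ ∩ riFace α).ncard := by
  intro α
  have hiff : ∀ β, (FixSet A₀ ∩ riFace β).Nonempty ↔ (FixSet A₁ ∩ riFace β).Nonempty := by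
    obtain ⟨A, hcont, rfl, rfl, hA, -, -⟩ := h
    have hpath := fun {a b : ℝ} (ha : a ∈ Set.Icc (0 : ℝ) 1) (hb : b ∈ Set.Icc (0 : ℝ) 1) β =>
      fixSet_inter_riFace_nonempty_of_path (α := β) isPreconnected_Icc hcont
        (fun t ht => (hA t ht).1.1) (fun t ht => (hA t ht).2) ha hb
    exact fun β => ⟨hpath (by simp) (by simp) β, hpath (by simp) (by simp) β⟩
  refine ⟨⟨?_, ?_⟩, ?_⟩
  · exact Set.Finite.of_finite_image (Set.toFinite _)
      (t₀.injOn_posSupport.mono Set.inter_subset_left)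
  · rw [← Set.InjOn.ncard_image (t₀.injOn_posSupport.mono Set.inter_subset_left),
      ← Set.InjOn.ncard_image (t₁.injOn_posSupport.mono Set.inter_subset_left),
      posSupport_image_fixSet_inter_face, posSupport_image_fixSet_inter_face]
    simp only [hiff]
  · rcases (t₀.subsingleton_fixSet_inter_riFace α).eq_empty_or_singleton with h0 | ⟨x, hx⟩
    · have h1 : FixSet A₁ ∩ riFace α = ∅ := by
        rw [← Set.not_nonempty_iff_eq_empty, ← hiff, h0]
        exact Set.not_nonempty_empty
      rw [h0, h1]
    · have hne : (FixSet A₁ ∩ riFace α).Nonempty := by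
        rw [← hiff, hx]
        exact Set.singleton_nonempty x
      obtain ⟨y, hy⟩ := hne
      rw [hx, (t₁.subsingleton_fixSet_inter_riFace α).eq_singleton_of_mem hy,
        Set.ncard_singleton, Set.ncard_singleton]
end
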